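/- arXiv:1207.2041 — 3 statements merged into one kernel-verified Lean document; each statement's English description precedes it below -/
import Mathlib

section
/- For all real numbers a > β ≥ 0 and any fixed unit vector e ∈ ℝ², the integral over the exterior of the disk of radius a of the inverse fourth power of the distance to the point βe equals ∫_{{x ∈ ℝ² : ‖x‖ ≥ a}} ‖x − β e‖^{-4} dx = π a² / (a² − β²)². -/
open Real MeasureTheory

lemma aux_key (a β : ℝ) (hβ : 0 ≤ β) (h : β < a)
    (p v : EuclideanSpace ℝ (Fin 2)) (hp : ‖p‖ = β) (hv : v ≠ 0) :
    a ≤ ‖(1 / ‖v‖) ^ 2 • v + p‖ ↔ ‖v - (a ^ 2 - β ^ 2)⁻¹ • p‖ ≤ a / (a ^ 2 - β ^ 2) := by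
  have hD : 0 < a ^ 2 - β ^ 2 := by nlinarith
  have ha : 0 < a := by linarith
  have hN : 0 < ‖v‖ := norm_pos_iff.2 hv
  rw [← sq_le_sq₀ ha.le (norm_nonneg _), ← sq_le_sq₀ (norm_nonneg _) (by positivity),
    norm_add_sq_real, norm_sub_sq_real, norm_smul, norm_smul, inner_smul_left, inner_smul_right,
    hp, Real.norm_of_nonneg (by positivity), Real.norm_of_nonneg (by positivity)]
  simp only [conj_trivial]
  generalize inner ℝ v p = i
  generalize ‖v‖ = N at *
  have e1 : ((1 / N) ^ 2 * N) ^ 2 + 2 * ((1 / N) ^ 2 * i) + β ^ 2 - a ^ 2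
      = (1 + 2 * i - (a ^ 2 - β ^ 2) * N ^ 2) / N ^ 2 := by
    field_simp
    ring
  have e2 : (a / (a ^ 2 - β ^ 2)) ^ 2 - (N ^ 2 - 2 * ((a ^ 2 - β ^ 2)⁻¹ * i)
      + ((a ^ 2 - β ^ 2)⁻¹ * β) ^ 2)
      = (1 + 2 * i - (a ^ 2 - β ^ 2) * N ^ 2) / (a ^ 2 - β ^ 2) := by
    field_simp
    ring
  rw [← sub_nonneg, e1, ← sub_nonneg (b := _ + _), e2, le_div_iff₀ (by positivity),
    le_div_iff₀ hD]
  simp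

/-- Exact mean interference integral for path-loss exponent 4: for `a > β ≥ 0` and a unit
vector `e ∈ ℝ²`, `∫_{‖x‖ ≥ a} ‖x − βe‖⁻⁴ dx = π a²/(a² − β²)²`. -/
theorem exterior_integral_inv_fourth (a β : ℝ) (hβ : 0 ≤ β) (h : β < a)
    (e : EuclideanSpace ℝ (Fin 2)) (he : ‖e‖ = 1) :
    (∫ x in {x : EuclideanSpace ℝ (Fin 2) | a ≤ ‖x‖}, (‖x - β • e‖ ^ 4)⁻¹) =
      π * a ^ 2 / (a ^ 2 - β ^ 2) ^ 2 := by
  have hp : ‖β • e‖ = β := by rw [norm_smul, he, mul_one, Real.norm_of_nonneg hβ]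
  generalize β • e = p at *
  have hD : 0 < a ^ 2 - β ^ 2 := by nlinarith
  have ha : 0 < a := by linarith
  set s := {x : EuclideanSpace ℝ (Fin 2) | a ≤ ‖x‖} with hs
  have hsm : MeasurableSet s := measurableSet_le measurable_const measurable_norm
  have hne : ∀ x ∈ s, x ≠ p := by
    rintro x hx rfl
    simp only [hs, Set.mem_setOf_eq] at hx
    linarith
  have himg : EuclideanGeometry.inversion p 1 '' s
      = Metric.closedBall (p + (a ^ 2 - β ^ 2)⁻¹ • p) (a / (a ^ 2 - β ^ 2)) \ {p} := by
    have hinv := EuclideanGeometry.inversion_involutive p (one_ne_zero (α := ℝ))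
    rw [Set.image_eq_preimage_of_inverse hinv.leftInverse hinv.rightInverse]
    ext y
    simp only [Set.mem_preimage, Set.mem_diff, Metric.mem_closedBall, Set.mem_singleton_iff]
    by_cases hy : y = p
    · subst hy
      simp [hs, hp, h]
    · have hk := aux_key a β hβ h p (y - p) hp (sub_ne_zero.2 hy)
      simp only [hs, hy, not_false_eq_true, and_true, Set.mem_setOf_eq,
        EuclideanGeometry.inversion_def, dist_eq_norm, vsub_eq_sub, vadd_eq_add]
      rw [hk, sub_sub]
  have key := integral_image_eq_integral_abs_det_fderiv_smul volume hsm
    (fun x hx => (EuclideanGeometry.hasFDerivAt_inversion (R := 1) (hne x hx)).hasFDerivWithinAt)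
    (EuclideanGeometry.inversion_injective p (one_ne_zero (α := ℝ))).injOn
    (fun _ => (1 : ℝ))
  rw [himg] at key
  have hdet : ∀ x : EuclideanSpace ℝ (Fin 2), |((1 / dist x p) ^ 2 •
      ((Submodule.span ℝ {x - p})ᗮ.reflection :
        EuclideanSpace ℝ (Fin 2) →L[ℝ] EuclideanSpace ℝ (Fin 2))).det| • (1 : ℝ)
      = (‖x - p‖ ^ 4)⁻¹ := by
    intro x
    have h1 := (Submodule.span ℝ {x - p})ᗮ.det_reflection
    have h2 : ((Submodule.span ℝ {x - p})ᗮ.reflection :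
        EuclideanSpace ℝ (Fin 2) →L[ℝ] EuclideanSpace ℝ (Fin 2)).det
        = (-1) ^ Module.finrank ℝ (Submodule.span ℝ {x - p})ᗮᗮ := h1
    have h3 : ∀ (c : ℝ) (A : EuclideanSpace ℝ (Fin 2) →L[ℝ] EuclideanSpace ℝ (Fin 2)),
        (c • A).det = c ^ 2 * A.det := by
      intro c A
      have := LinearMap.det_smul c (A : EuclideanSpace ℝ (Fin 2) →ₗ[ℝ] EuclideanSpace ℝ (Fin 2))
      rw [finrank_euclideanSpace_fin] at this
      exact this
    rw [h3, h2, abs_mul, abs_pow (-1 : ℝ), dist_eq_norm]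
    simp [← pow_mul]
  simp only [hdet] at key
  rw [← key, setIntegral_const, measureReal_def, measure_diff_null (measure_singleton p),
    EuclideanSpace.volume_closedBall_fin_two]
  rw [ENNReal.toReal_mul, ENNReal.toReal_pow, ENNReal.toReal_ofReal (by positivity),
    ENNReal.toReal_ofReal pi_pos.le]
  simp only [smul_eq_mul]
  field_simp
end

section
/- For all real numbers a > β ≥ 0 and any fixed unit vector e ∈ ℝ², ∫_{{x ∈ ℝ² : ‖x‖ ≥ a}} ‖x − β e‖^{-8} dx = π a² (a⁴ + 6a²β² + 3β⁴) / (3 (a² − β²)⁶). -/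
open Real MeasureTheory

/-- The squared distance in polar coordinates. -/
noncomputable def dd (r β θ : ℝ) : ℝ := r ^ 2 + β ^ 2 - 2 * r * β * Real.cos θ

lemma dd_ge (r β θ : ℝ) (hβ : 0 ≤ β) (h : β < r) : (r - β) ^ 2 ≤ dd r β θ := by
  unfold dd
  nlinarith [mul_nonneg (mul_nonneg hβ (hβ.trans h.le)) (sub_nonneg.2 (Real.cos_le_one θ))]

lemma dd_pos (r β θ : ℝ) (hβ : 0 ≤ β) (h : β < r) : 0 < dd r β θ :=
  lt_of_lt_of_le (by have := sub_pos.2 h; positivity) (dd_ge r β θ hβ h)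

lemma norm_polar (r β θ : ℝ) :
    ‖(r : ℂ) * (Real.cos θ + Real.sin θ * Complex.I) - β‖ ^ 2 = dd r β θ := by
  rw [← Complex.normSq_eq_norm_sq, Complex.normSq_apply]
  simp [dd, Complex.cos_ofReal_re, Complex.sin_ofReal_re, Complex.cos_ofReal_im,
    Complex.sin_ofReal_im]
  linear_combination r ^ 2 * Real.sin_sq_add_cos_sq θ

lemma cont_dd (r β : ℝ) : Continuous (dd r β) := by unfold dd; fun_prop

lemma int_dd (r β : ℝ) (hβ : 0 ≤ β) (h : β < r) (k : ℕ) :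
    IntervalIntegrable (fun θ => (dd r β θ ^ k)⁻¹) volume (-π) π := by
  apply Continuous.intervalIntegrable
  exact ((cont_dd r β).pow k).inv₀ fun θ => (pow_pos (dd_pos r β θ hβ h) k).ne'

lemma angular_one (r β : ℝ) (hβ : 0 ≤ β) (h : β < r) :
    ∫ θ in (-π)..π, (dd r β θ ^ 1)⁻¹ = 2 * π / (r ^ 2 - β ^ 2) := by
  have hr : 0 < r := hβ.trans_lt h
  have h1 : DiffContOnCl ℂ (fun _ : ℂ => (1 : ℂ)) (Metric.ball 0 r) := diffContOnCl_const
  have h2 := h1.circleAverage_poissonKernel_smul' (w := (β : ℂ))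
    (by simpa [abs_of_nonneg hβ] using h)
  have h3 : ∀ θ : ℝ, ((‖circleMap 0 r θ - 0‖ ^ 2 - ‖(β : ℂ) - 0‖ ^ 2) /
      ‖(circleMap 0 r θ - 0) - ((β : ℂ) - 0)‖ ^ 2) • (1 : ℂ) =
      (((r ^ 2 - β ^ 2) * (dd r β θ ^ 1)⁻¹ : ℝ) : ℂ) := by
    intro θ
    have : circleMap 0 r θ = (r : ℂ) * (Real.cos θ + Real.sin θ * Complex.I) := by
      simp [circleMap, Complex.exp_mul_I]
    rw [show ‖(circleMap 0 r θ - 0) - ((β : ℂ) - 0)‖ ^ 2 = dd r β θ by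
      rw [sub_zero, sub_zero, this, norm_polar]]
    simp [div_eq_mul_inv]
  rw [Real.circleAverage_def] at h2
  simp_rw [h3] at h2
  rw [intervalIntegral.integral_ofReal, intervalIntegral.integral_const_mul] at h2
  have hper : Function.Periodic (fun θ => (dd r β θ ^ 1)⁻¹) (2 * π) := by
    intro θ; simp [dd]
  have h4 := hper.intervalIntegral_add_eq (-π) 0
  rw [show -π + 2 * π = π by ring, zero_add] at h4
  rw [h4]
  have h5 : (2 * π)⁻¹ * ((r ^ 2 - β ^ 2) * ∫ θ in (0)..(2 * π), (dd r β θ ^ 1)⁻¹) = 1 := by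
    apply Complex.ofReal_injective
    simpa using h2
  have : r ^ 2 - β ^ 2 ≠ 0 := by nlinarith
  have := Real.pi_pos
  field_simp at h5 ⊢
  linarith

lemma angular_rec (r β : ℝ) (hβ : 0 ≤ β) (h : β < r) (k : ℕ) :
    (k + 1) * (r ^ 2 - β ^ 2) ^ 2 * ∫ θ in (-π)..π, (dd r β θ ^ (k + 2))⁻¹ =
    (2 * k + 1) * (r ^ 2 + β ^ 2) * (∫ θ in (-π)..π, (dd r β θ ^ (k + 1))⁻¹) -
     k * ∫ θ in (-π)..π, (dd r β θ ^ k)⁻¹ := by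
  have hd : ∀ θ ∈ Set.uIcc (-π) π,
      HasDerivAt (fun θ => 2 * r * β * Real.sin θ * (dd r β θ ^ (k + 1))⁻¹)
      ((k + 1) * (r ^ 2 - β ^ 2) ^ 2 * (dd r β θ ^ (k + 2))⁻¹ -
        (2 * k + 1) * (r ^ 2 + β ^ 2) * (dd r β θ ^ (k + 1))⁻¹ + k * (dd r β θ ^ k)⁻¹) θ := by
    intro θ _
    have hp := dd_pos r β θ hβ h
    have e1 : HasDerivAt (dd r β) (2 * r * β * Real.sin θ) θ := by
      have := ((Real.hasDerivAt_cos θ).const_mul (2 * r * β)).const_sub (r ^ 2 + β ^ 2)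
      convert! this using 1
      ring
    have e2 := (e1.pow (k + 1)).inv (pow_pos hp _).ne'
    have e3 := ((Real.hasDerivAt_sin θ).const_mul (2 * r * β)).mul e2
    convert! e3 using 1
    simp only [Nat.add_sub_cancel, Pi.pow_apply, Pi.inv_apply]
    have hc : 2 * r * β * Real.cos θ = r ^ 2 + β ^ 2 - dd r β θ := by unfold dd; ring
    have hs : (2 * r * β * Real.sin θ) ^ 2 = (2 * r * β) ^ 2 - (r ^ 2 + β ^ 2 - dd r β θ) ^ 2 := by
      rw [← hc]; linear_combination (2 * r * β) ^ 2 * Real.sin_sq_add_cos_sq θ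
    rw [hc]
    generalize dd r β θ = D at *
    push_cast
    field_simp
    linear_combination (k + 1 : ℝ) * D ^ (3 * k + 2) * hs
  have i0 := int_dd r β hβ h k
  have i1 := int_dd r β hβ h (k + 1)
  have i2 := int_dd r β hβ h (k + 2)
  have j2 := i2.const_mul ((k + 1) * (r ^ 2 - β ^ 2) ^ 2)
  have j1 := i1.const_mul ((2 * k + 1) * (r ^ 2 + β ^ 2))
  have j0 := i0.const_mul (k : ℝ)
  have := intervalIntegral.integral_eq_sub_of_hasDerivAt hd ((j2.sub j1).add j0)
  rw [intervalIntegral.integral_add (j2.sub j1) j0, intervalIntegral.integral_sub j2 j1,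
    intervalIntegral.integral_const_mul, intervalIntegral.integral_const_mul,
    intervalIntegral.integral_const_mul] at this
  simp at this
  linarith

lemma angular (r β : ℝ) (hβ : 0 ≤ β) (h : β < r) :
    ∫ θ in (-π)..π, (dd r β θ ^ 4)⁻¹ =
    2 * π * (r ^ 6 + 9 * r ^ 4 * β ^ 2 + 9 * r ^ 2 * β ^ 4 + β ^ 6) / (r ^ 2 - β ^ 2) ^ 7 := by
  have h1 := angular_one r β hβ h
  have h2 := angular_rec r β hβ h 0
  have h3 := angular_rec r β hβ h 1
  have h4 := angular_rec r β hβ h 2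
  have hne : r ^ 2 - β ^ 2 ≠ 0 := by nlinarith
  norm_num only [Nat.cast_zero, Nat.cast_one, Nat.cast_ofNat, zero_mul, sub_zero] at h2 h3 h4
  set I1 := ∫ θ in (-π)..π, (dd r β θ ^ 1)⁻¹
  set I2 := ∫ θ in (-π)..π, (dd r β θ ^ 2)⁻¹
  set I3 := ∫ θ in (-π)..π, (dd r β θ ^ 3)⁻¹
  set I4 := ∫ θ in (-π)..π, (dd r β θ ^ 4)⁻¹
  have k2 : I2 = (r ^ 2 + β ^ 2) * I1 / (r ^ 2 - β ^ 2) ^ 2 := by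
    rw [eq_div_iff (by positivity)]; linarith
  have k3 : I3 = (3 * (r ^ 2 + β ^ 2) * I2 - I1) / (2 * (r ^ 2 - β ^ 2) ^ 2) := by
    rw [eq_div_iff (by positivity)]; linarith
  have k4 : I4 = (5 * (r ^ 2 + β ^ 2) * I3 - 2 * I2) / (3 * (r ^ 2 - β ^ 2) ^ 2) := by
    rw [eq_div_iff (by positivity)]; linarith
  rw [k4, k3, k2, h1]
  field_simp
  ring

lemma radial (a β : ℝ) (hβ : 0 ≤ β) (h : β < a) :
    ∫ r in Set.Ioi a, r * (2 * π * (r ^ 6 + 9 * r ^ 4 * β ^ 2 + 9 * r ^ 2 * β ^ 4 + β ^ 6) /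
      (r ^ 2 - β ^ 2) ^ 7) =
      π * a ^ 2 * (a ^ 4 + 6 * a ^ 2 * β ^ 2 + 3 * β ^ 4) / (3 * (a ^ 2 - β ^ 2) ^ 6) := by
  have key := integral_Ioi_of_hasDerivAt_of_nonneg' (a := a) (l := 0)
    (g := fun r => -(π * r ^ 2 * (r ^ 4 + 6 * r ^ 2 * β ^ 2 + 3 * β ^ 4) /
      (3 * (r ^ 2 - β ^ 2) ^ 6)))
    (g' := fun r => r * (2 * π * (r ^ 6 + 9 * r ^ 4 * β ^ 2 + 9 * r ^ 2 * β ^ 4 + β ^ 6) /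
      (r ^ 2 - β ^ 2) ^ 7)) ?_ ?_ ?_
  · rw [key]; ring
  · intro r hr
    have hr' : β < r := h.trans_le hr
    have hne : r ^ 2 - β ^ 2 ≠ 0 := by nlinarith
    have n1 : HasDerivAt (fun r : ℝ => π * r ^ 2 * (r ^ 4 + 6 * r ^ 2 * β ^ 2 + 3 * β ^ 4))
        (π * (6 * r ^ 5 + 24 * r ^ 3 * β ^ 2 + 6 * r * β ^ 4)) r := by
      have := (((hasDerivAt_pow 6 r).add ((hasDerivAt_pow 4 r).const_mul (6 * β ^ 2))).add
        ((hasDerivAt_pow 2 r).const_mul (3 * β ^ 4))).const_mul π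
      convert! this using 1
      · ext x; simp; ring
      · norm_num; ring
    have n2 : HasDerivAt (fun r : ℝ => 3 * (r ^ 2 - β ^ 2) ^ 6)
        (36 * r * (r ^ 2 - β ^ 2) ^ 5) r := by
      have := (((hasDerivAt_pow 2 r).sub_const (β ^ 2)).pow 6).const_mul 3
      convert! this using 1
      norm_num; ring
    have := (n1.div n2 (by positivity)).neg
    convert! this using 1
    field_simp
    ring
  · intro r hr
    have hr' : β < r := h.trans hr
    have h0 : 0 < r := hβ.trans_lt hr'
    have hne : 0 < r ^ 2 - β ^ 2 := by nlinarith
    positivity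
  · have t0 : Filter.Tendsto (fun r : ℝ => r⁻¹) Filter.atTop (nhds 0) := tendsto_inv_atTop_zero
    have t1 : Filter.Tendsto (fun r : ℝ => -(π * r⁻¹ ^ 6 * (1 + 6 * r⁻¹ ^ 2 * β ^ 2 +
        3 * β ^ 4 * r⁻¹ ^ 4) / (3 * (1 - β ^ 2 * r⁻¹ ^ 2) ^ 6))) Filter.atTop (nhds
        (-(π * 0 ^ 6 * (1 + 6 * 0 ^ 2 * β ^ 2 +
        3 * β ^ 4 * 0 ^ 4) / (3 * (1 - β ^ 2 * 0 ^ 2) ^ 6)))) := by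
      have hc : ContinuousAt (fun x : ℝ => -(π * x ^ 6 * (1 + 6 * x ^ 2 * β ^ 2 +
        3 * β ^ 4 * x ^ 4) / (3 * (1 - β ^ 2 * x ^ 2) ^ 6))) 0 := by
        apply ContinuousAt.neg
        apply ContinuousAt.div (by fun_prop) (by fun_prop)
        norm_num
      exact hc.tendsto.comp t0
    norm_num at t1
    refine t1.congr' ?_
    filter_upwards [Filter.eventually_gt_atTop a] with r hr
    have hr' : β < r := h.trans hr
    have h0 : 0 < r := hβ.trans_lt hr'
    have hne : r ^ 2 - β ^ 2 ≠ 0 := by nlinarith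
    have e1 : 1 - β ^ 2 * (r ^ 2)⁻¹ = (r ^ 2 - β ^ 2) / r ^ 2 := by field_simp
    rw [e1]
    field_simp

lemma integrable_polar (a β : ℝ) (hβ : 0 ≤ β) (h : β < a) :
    IntegrableOn (fun p : ℝ × ℝ => p.1 * (dd p.1 β p.2 ^ 4)⁻¹)
      (Set.Ioi a ×ˢ Set.Ioo (-π) π) (volume.prod volume) := by
  have ha : 0 < a := hβ.trans_lt h
  have hc : 0 < 1 - β / a := by rw [sub_pos, div_lt_one ha]; exact h
  have g1 : IntegrableOn (fun r : ℝ => ((1 - β / a) ^ 8)⁻¹ * r ^ (-7 : ℝ)) (Set.Ioi a) :=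
    (integrableOn_Ioi_rpow_of_lt (by norm_num) ha).const_mul _
  have g2 : IntegrableOn (fun _ : ℝ => (1 : ℝ)) (Set.Ioo (-π) π) := by simp
  have g3 := Integrable.mul_prod g1 g2
  rw [Measure.prod_restrict] at g3
  refine Integrable.mono' g3 ?_ ?_
  · apply Measurable.aestronglyMeasurable
    unfold dd
    fun_prop
  · rw [ae_restrict_iff' (measurableSet_Ioi.prod measurableSet_Ioo)]
    refine Filter.Eventually.of_forall fun p hp => ?_
    have hr : a < p.1 := hp.1
    have h0 : 0 < p.1 := ha.trans hr
    have hd := dd_ge p.1 β p.2 hβ (h.trans hr)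
    have hd' := dd_pos p.1 β p.2 hβ (h.trans hr)
    rw [Real.norm_of_nonneg (by positivity)]
    have b1 : (1 - β / a) * p.1 ≤ p.1 - β := by
      have : β ≤ β / a * p.1 := by
        rw [div_mul_eq_mul_div, le_div_iff₀ ha]; nlinarith
      linarith
    have b2 : ((1 - β / a) * p.1) ^ 8 ≤ dd p.1 β p.2 ^ 4 := by
      calc ((1 - β / a) * p.1) ^ 8 ≤ (p.1 - β) ^ 8 := by gcongr
        _ = ((p.1 - β) ^ 2) ^ 4 := by ring
        _ ≤ _ := by gcongr
    have e7 : p.1 ^ (-7 : ℝ) = (p.1 ^ 7)⁻¹ := by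
      rw [Real.rpow_neg h0.le]; norm_cast
    rw [e7, mul_one]
    calc p.1 * (dd p.1 β p.2 ^ 4)⁻¹ ≤ p.1 * (((1 - β / a) * p.1) ^ 8)⁻¹ := by gcongr
      _ = _ := by rw [mul_pow, mul_inv]; field_simp

lemma complex_version (a β : ℝ) (hβ : 0 ≤ β) (h : β < a) :
    (∫ z in {z : ℂ | a ≤ ‖z‖}, (‖z - β‖ ^ 8)⁻¹) =
      π * a ^ 2 * (a ^ 4 + 6 * a ^ 2 * β ^ 2 + 3 * β ^ 4) / (3 * (a ^ 2 - β ^ 2) ^ 6) := by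
  have ha : 0 < a := hβ.trans_lt h
  have hm : MeasurableSet {z : ℂ | a ≤ ‖z‖} := measurableSet_le measurable_const measurable_norm
  rw [← integral_indicator hm, ← Complex.integral_comp_polarCoord_symm]
  have e1 : (∫ p in polarCoord.target, p.1 • Set.indicator {z : ℂ | a ≤ ‖z‖}
      (fun z => (‖z - β‖ ^ 8)⁻¹) (Complex.polarCoord.symm p)) =
      ∫ p in polarCoord.target, Set.indicator (Set.Ici a ×ˢ Set.univ)
        (fun p : ℝ × ℝ => p.1 * (dd p.1 β p.2 ^ 4)⁻¹) p := by
    apply setIntegral_congr_fun polarCoord.open_target.measurableSet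
    intro p hp
    have hp0 : 0 < p.1 := hp.1
    have hn : ‖Complex.polarCoord.symm p‖ = p.1 := by
      rw [Complex.norm_polarCoord_symm, abs_of_pos hp0]
    by_cases hpa : a ≤ p.1
    · have hmem : Complex.polarCoord.symm p ∈ {z : ℂ | a ≤ ‖z‖} := by
        rw [Set.mem_setOf_eq, hn]; exact hpa
      simp only
      rw [Set.indicator_of_mem hmem]
      rw [Set.indicator_of_mem (by simpa using hpa), smul_eq_mul,
        ← norm_polar, Complex.polarCoord_symm_apply, ← pow_mul]
    · have hmem : Complex.polarCoord.symm p ∉ {z : ℂ | a ≤ ‖z‖} := by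
        rw [Set.mem_setOf_eq, hn]; exact hpa
      simp only
      rw [Set.indicator_of_notMem hmem]
      rw [Set.indicator_of_notMem (by simpa using hpa), smul_zero]
  rw [e1, setIntegral_indicator (measurableSet_Ici.prod MeasurableSet.univ)]
  have e2 : polarCoord.target ∩ (Set.Ici a ×ˢ Set.univ) = Set.Ici a ×ˢ Set.Ioo (-π) π := by
    ext p
    simp only [polarCoord_target, Set.mem_inter_iff, Set.mem_prod, Set.mem_Ioi, Set.mem_Ici,
      Set.mem_univ, and_true]
    constructor
    · rintro ⟨⟨_, h2⟩, h3⟩; exact ⟨h3, h2⟩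
    · rintro ⟨h3, h2⟩; exact ⟨⟨ha.trans_le h3, h2⟩, h3⟩
  have hae : (Set.Ici a ×ˢ Set.Ioo (-π) π : Set (ℝ × ℝ)) =ᵐ[volume.prod volume]
      (Set.Ioi a ×ˢ Set.Ioo (-π) π : Set (ℝ × ℝ)) :=
    Measure.set_prod_ae_eq Ioi_ae_eq_Ici.symm (Filter.EventuallyEq.refl _ _)
  rw [e2, Measure.volume_eq_prod, setIntegral_congr_set hae,
    setIntegral_prod _ (integrable_polar a β hβ h), ← radial a β hβ h]
  apply setIntegral_congr_fun measurableSet_Ioi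
  intro r hr
  simp only
  rw [integral_const_mul, ← integral_Ioc_eq_integral_Ioo,
    ← intervalIntegral.integral_of_le (by linarith [Real.pi_pos]), angular r β hβ (h.trans hr)]

lemma exists_iso (e : EuclideanSpace ℝ (Fin 2)) (he : ‖e‖ = 1) :
    ∃ f : ℂ ≃ₗᵢ[ℝ] EuclideanSpace ℝ (Fin 2), f 1 = e := by
  obtain ⟨b, hb⟩ := Orthonormal.exists_orthonormalBasis_extension_of_card_eq (𝕜 := ℝ)
    (E := EuclideanSpace ℝ (Fin 2)) (ι := Fin 2) (by simp) (v := fun _ => e) (s := {0}) (by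
      constructor
      · intro i; simpa using he
      · intro i j hij; exact absurd (Subsingleton.elim i j) hij)
  refine ⟨Complex.isometryOfOrthonormal b, ?_⟩
  rw [Complex.isometryOfOrthonormal_apply]
  simp [hb 0 rfl]

/-- Exact second-moment interference integral for path-loss exponent 4: for `a > β ≥ 0` and
a unit vector `e ∈ ℝ²`,
`∫_{‖x‖ ≥ a} ‖x − βe‖⁻⁸ dx = π a² (a⁴ + 6a²β² + 3β⁴)/(3(a² − β²)⁶)`. -/
theorem exterior_integral_inv_eighth (a β : ℝ) (hβ : 0 ≤ β) (h : β < a)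
    (e : EuclideanSpace ℝ (Fin 2)) (he : ‖e‖ = 1) :
    (∫ x in {x : EuclideanSpace ℝ (Fin 2) | a ≤ ‖x‖}, (‖x - β • e‖ ^ 8)⁻¹) =
      π * a ^ 2 * (a ^ 4 + 6 * a ^ 2 * β ^ 2 + 3 * β ^ 4) / (3 * (a ^ 2 - β ^ 2) ^ 6) := by
  obtain ⟨f, hf⟩ := exists_iso e he
  rw [← complex_version a β hβ h, ← f.measurePreserving.setIntegral_preimage_emb
    f.toHomeomorph.measurableEmbedding]
  have hs : f ⁻¹' {x : EuclideanSpace ℝ (Fin 2) | a ≤ ‖x‖} = {z : ℂ | a ≤ ‖z‖} := by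
    ext z; simp
  rw [hs]
  congr 1
  ext z
  have : f z - β • e = f (z - β) := by
    rw [← hf, ← map_smul, ← map_sub]; simp
  rw [this, f.norm_map]
end

section
/- (Success Probability for Gamma Signal and Gamma Interference) Let S ~ Γ[k_s, θ_s] and I ~ Γ[k_i, θ_i] be independent Gamma random variables with k_s, θ_s, k_i, θ_i > 0, and let T > 0. Then P(S/I > T) = [Γ(k_s + k_i)/Γ(k_s)] · (θ_s/(T θ_i))^{k_i} · ₂F̃₁(k_i, k_s + k_i; 1 + k_i; −θ_s/(T θ_i)), where for these parameters the regularized Gauss hypergeometric function is given by the convergent Euler integral ₂F̃₁(k_i, k_s + k_i; 1 + k_i; z) = (1/Γ(k_i)) ∫₀¹ t^{k_i − 1} (1 − z t)^{−(k_s + k_i)} dt for z ≤ 0. Equivalently, P(S/I > T) = [Γ(k_s + k_i)/(Γ(k_s)Γ(k_i))] (θ_s/(T θ_i))^{k_i} ∫₀¹ t^{k_i−1} (1 + (θ_s/(T θ_i)) t)^{−(k_s+k_i)} dt. -/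
open MeasureTheory ProbabilityTheory Real

lemma aux_pdf (ks θs ki θi T s t : ℝ) (hks : 0 < ks) (hθs : 0 < θs)
    (hki : 0 < ki) (hθi : 0 < θi) (hT : 0 < T) (hs : 0 < s) (ht : 0 < t) :
    gammaPDF ks θs⁻¹ s * (ENNReal.ofReal (s / T) * gammaPDF ki θi⁻¹ (s / T * t)) =
    ENNReal.ofReal (Real.Gamma (ks + ki) / (Real.Gamma ks * Real.Gamma ki) * (θs / (T * θi)) ^ ki *
        (t ^ (ki - 1) * (1 + θs / (T * θi) * t) ^ (-(ks + ki)))) *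
      gammaPDF (ks + ki) (θs⁻¹ * (1 + θs / (T * θi) * t)) s := by
  have hw : 0 < 1 + θs / (T * θi) * t := by positivity
  have hexp : θs⁻¹ * (1 + θs / (T * θi) * t) * s = θs⁻¹ * s + θi⁻¹ * (s / T * t) := by
    field_simp
  have g1 := Real.Gamma_pos_of_pos hks
  have g2 := Real.Gamma_pos_of_pos hki
  have g3 := Real.Gamma_pos_of_pos (add_pos hks hki)
  rw [gammaPDF_of_nonneg hs.le, gammaPDF_of_nonneg (by positivity), gammaPDF_of_nonneg hs.le,
    ← ENNReal.ofReal_mul (by positivity), ← ENNReal.ofReal_mul (by positivity),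
    ← ENNReal.ofReal_mul (by positivity), hexp, neg_add (θs⁻¹ * s), Real.exp_add]
  congr 1
  generalize 1 + θs / (T * θi) * t = w at hw
  rw [Real.rpow_neg hw.le, Real.mul_rpow (by positivity) hw.le,
    Real.mul_rpow (by positivity) ht.le, Real.div_rpow hs.le hT.le,
    Real.div_rpow hθs.le (by positivity), Real.mul_rpow hT.le hθi.le,
    Real.inv_rpow hθs.le, Real.inv_rpow hθs.le, Real.inv_rpow hθi.le,
    Real.rpow_add hθs, Real.rpow_sub_one hs.ne', Real.rpow_sub_one hs.ne',
    Real.rpow_sub_one hs.ne', Real.rpow_sub_one hT.ne', Real.rpow_add hs]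
  have := Real.rpow_pos_of_pos hw (ks + ki)
  have := Real.rpow_pos_of_pos hθs ks
  have := Real.rpow_pos_of_pos hθs ki
  have := Real.rpow_pos_of_pos hθi ki
  have := Real.rpow_pos_of_pos hT ki
  generalize w ^ (ks + ki) = W at *
  generalize θs ^ ks = A1 at *
  generalize θs ^ ki = A2 at *
  generalize θi ^ ki = A3 at *
  generalize T ^ ki = A4 at *
  generalize t ^ (ki - 1) = A5 at *
  generalize rexp _ = E1
  generalize rexp _ = E2
  field_simp

lemma aux_scale (c : ℝ) (hc : 0 < c) (f : ℝ → ENNReal) :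
    ∫⁻ x in Set.Ioo 0 c, f x = ∫⁻ t in Set.Ioo (0 : ℝ) 1, ENNReal.ofReal c * f (c * t) := by
  have him : (fun t => c * t) '' Set.Ioo (0 : ℝ) 1 = Set.Ioo 0 c := by
    rw [Set.image_mul_left_Ioo hc]; simp
  rw [← him, lintegral_image_eq_lintegral_abs_deriv_mul (f' := fun _ => c) measurableSet_Ioo]
  · simp [abs_of_pos hc]
  · intro x _
    simpa using ((hasDerivAt_id x).const_mul c).hasDerivWithinAt
  · exact (mul_right_injective₀ hc.ne').injOn

lemma meas_pdf (a r : ℝ) : Measurable (gammaPDF a r) :=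
  (measurable_gammaPDFReal a r).ennreal_ofReal

lemma aux_inner (ki θi T s : ℝ) (hT : 0 < T) (hs : 0 < s) :
    gammaMeasure ki θi⁻¹ {i | T < s / i} =
    ∫⁻ t in Set.Ioo (0 : ℝ) 1, ENNReal.ofReal (s / T) * gammaPDF ki θi⁻¹ (s / T * t) := by
  have hset : {i : ℝ | T < s / i} = Set.Ioo 0 (s / T) := by
    ext i
    simp only [Set.mem_setOf_eq, Set.mem_Ioo]
    constructor
    · intro h
      have hi : 0 < i := by
        by_contra hi
        have := div_nonpos_of_nonneg_of_nonpos hs.le (not_lt.mp hi)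
        linarith
      refine ⟨hi, ?_⟩
      rw [lt_div_iff₀ hi] at h
      rw [lt_div_iff₀ hT]; linarith
    · rintro ⟨hi, h⟩
      rw [lt_div_iff₀ hT] at h
      rw [lt_div_iff₀ hi]; linarith
  rw [hset, gammaMeasure, withDensity_apply _ measurableSet_Ioo, aux_scale _ (by positivity)]

lemma lint_Ioi (a r : ℝ) (ha : 0 < a) (hr : 0 < r) :
    ∫⁻ s in Set.Ioi (0 : ℝ), gammaPDF a r s = 1 := by
  rw [← lintegral_gammaPDF_eq_one ha hr, ← lintegral_add_compl (μ := volume) _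
    (measurableSet_Ici (a := (0 : ℝ))), Set.compl_Ici, lintegral_gammaPDF_of_nonpos le_rfl,
    add_zero]
  exact setLIntegral_congr Ioi_ae_eq_Ici

lemma outer (a r : ℝ) (f : ℝ → ENNReal) (hf : Measurable f) :
    ∫⁻ s, f s ∂(gammaMeasure a r) = ∫⁻ s in Set.Ioi (0 : ℝ), gammaPDF a r s * f s := by
  rw [gammaMeasure, lintegral_withDensity_eq_lintegral_mul _ (meas_pdf a r) hf,
    ← lintegral_add_compl (μ := volume) _ (measurableSet_Ici (a := (0 : ℝ))), Set.compl_Ici,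
    setLIntegral_congr Ioi_ae_eq_Ici]
  have : ∫⁻ s in Set.Iio (0 : ℝ), (gammaPDF a r * f) s = 0 := by
    rw [setLIntegral_congr_fun (g := fun _ ↦ 0) measurableSet_Iio, lintegral_zero]
    intro x hx
    simp [gammaPDF_of_neg hx]
  rw [this, add_zero]
  rfl

/-- **Success Probability for Gamma Signal and Gamma Interference.** If `S ~ Γ[k_s, θ_s]`
and `I ~ Γ[k_i, θ_i]` are independent and `T > 0`, then
`P(S/I > T) = Γ(k_s+k_i)/(Γ(k_s)Γ(k_i)) (θ_s/(Tθ_i))^{k_i}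
  ∫₀¹ t^{k_i−1} (1 + (θ_s/(Tθ_i)) t)^{−(k_s+k_i)} dt`,
which is the regularized Gauss hypergeometric expression
`(Γ(k_s+k_i)/Γ(k_s)) (θ_s/(Tθ_i))^{k_i} ₂F̃₁(k_i, k_s+k_i; 1+k_i; −θ_s/(Tθ_i))` with the
hypergeometric function written via its Euler integral. -/
theorem success_prob_gamma_gamma {Ω : Type*} [MeasurableSpace Ω] (μ : Measure Ω)
    [IsProbabilityMeasure μ] (ks θs ki θi T : ℝ) (hks : 0 < ks) (hθs : 0 < θs)
    (hki : 0 < ki) (hθi : 0 < θi) (hT : 0 < T) (S I : Ω → ℝ)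
    (hS : Measurable S) (hI : Measurable I)
    (hlawS : Measure.map S μ = gammaMeasure ks θs⁻¹)
    (hlawI : Measure.map I μ = gammaMeasure ki θi⁻¹)
    (hindep : IndepFun S I μ) :
    (μ {ω | T < S ω / I ω}).toReal =
      Real.Gamma (ks + ki) / (Real.Gamma ks * Real.Gamma ki) * (θs / (T * θi)) ^ ki *
        ∫ t in (0 : ℝ)..1, t ^ (ki - 1) * (1 + θs / (T * θi) * t) ^ (-(ks + ki)) := by
  have hmap := (indepFun_iff_map_prod_eq_prod_map_map hS.aemeasurable hI.aemeasurable).1 hindep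
  have hms : MeasurableSet {p : ℝ × ℝ | T < p.1 / p.2} :=
    measurableSet_lt measurable_const (measurable_fst.div measurable_snd)
  have p1 := isProbabilityMeasure_gammaMeasure hks (inv_pos.2 hθs)
  have p2 := isProbabilityMeasure_gammaMeasure hki (inv_pos.2 hθi)
  have h1 : μ {ω | T < S ω / I ω} =
      ∫⁻ s, gammaMeasure ki θi⁻¹ {i | T < s / i} ∂(gammaMeasure ks θs⁻¹) := by
    have : μ {ω | T < S ω / I ω} = (μ.map (fun ω => (S ω, I ω))) {p : ℝ × ℝ | T < p.1 / p.2} := by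
      rw [Measure.map_apply (hS.prodMk hI) hms]; rfl
    rw [this, hmap, hlawS, hlawI, Measure.prod_apply hms]; rfl
  have hm : Measurable fun s : ℝ => gammaMeasure ki θi⁻¹ {i | T < s / i} :=
    measurable_measure_prodMk_left hms
  have h2 : μ {ω | T < S ω / I ω} = ∫⁻ t in Set.Ioo (0 : ℝ) 1,
      ENNReal.ofReal (Real.Gamma (ks + ki) / (Real.Gamma ks * Real.Gamma ki) *
        (θs / (T * θi)) ^ ki * (t ^ (ki - 1) * (1 + θs / (T * θi) * t) ^ (-(ks + ki)))) := by
    rw [h1, outer _ _ _ hm]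
    have e1 : ∫⁻ s in Set.Ioi (0 : ℝ), gammaPDF ks θs⁻¹ s * gammaMeasure ki θi⁻¹ {i | T < s / i}
        = ∫⁻ s in Set.Ioi (0 : ℝ), ∫⁻ t in Set.Ioo (0 : ℝ) 1,
          gammaPDF ks θs⁻¹ s * (ENNReal.ofReal (s / T) * gammaPDF ki θi⁻¹ (s / T * t)) := by
      refine setLIntegral_congr_fun measurableSet_Ioi fun s hs => ?_
      rw [aux_inner ki θi T s hT hs, lintegral_const_mul (gammaPDF ks θs⁻¹ s)]
      have := meas_pdf ki θi⁻¹
      fun_prop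
    rw [e1, lintegral_lintegral_swap]
    · refine setLIntegral_congr_fun measurableSet_Ioo fun t ht => ?_
      have ht0 : 0 < t := ht.1
      have hw : 0 < θs⁻¹ * (1 + θs / (T * θi) * t) := by positivity
      rw [setLIntegral_congr_fun measurableSet_Ioi fun s hs =>
        aux_pdf ks θs ki θi T s t hks hθs hki hθi hT hs ht0,
        lintegral_const_mul _ (meas_pdf _ _), lint_Ioi _ _ (add_pos hks hki) hw, mul_one]
    · have := meas_pdf ki θi⁻¹
      have := meas_pdf ks θs⁻¹
      apply Measurable.aemeasurable
      unfold Function.uncurry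
      fun_prop
  rw [h2, ← intervalIntegral.integral_const_mul, intervalIntegral.integral_of_le zero_le_one,
    integral_Ioc_eq_integral_Ioo, integral_eq_lintegral_of_nonneg_ae]
  · filter_upwards [ae_restrict_mem measurableSet_Ioo] with t ht
    have ht0 : 0 < t := ht.1
    have g1 := Real.Gamma_pos_of_pos hks
    have g2 := Real.Gamma_pos_of_pos hki
    have g3 := Real.Gamma_pos_of_pos (add_pos hks hki)
    simp only [Pi.zero_apply]
    positivity
  · apply Measurable.aestronglyMeasurable
    fun_prop
end
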